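/- arXiv:2104.11853 — 2 statements merged into one kernel-verified Lean document; each statement's English description precedes it below -/
import Mathlib

section
/- (Carleman-like estimates (4.10).) Assume u = 0 on ∂E, and assume the uniform bounds 0 < a ≤ A_θ, A_z ≤ A, |∇A_θ| + |∇A_z| ≤ B on E, and that there exists ρ ∈ C¹(closure of E) with κ_z = ρ κ_θ on E, 0 < ρ₀ ≤ ρ ≤ ρ₁, and |∇ρ| ≤ c₂. Then there exist constants λ₀, C > 0, depending only on a, A, B, ρ₀, ρ₁, c₂, such that for every λ ≥ λ₀: ∫_E e^{λz} u_θ² ≤ C ( λ^{−1} ∫_E e^{λz} |F^sym|² + ∫_E e^{λz} u_z² ) and ∫_E e^{λz} u_z² ≤ C ( λ^{−1} ∫_E e^{λz} |F^sym|² + ∫_E e^{λz} u_θ² ). -/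
open MeasureTheory Set Real

noncomputable section

/-- Partial derivative in `θ` of a scalar function on the parameter plane `(θ, z)`. -/
def dTh (f : ℝ × ℝ → ℝ) (p : ℝ × ℝ) : ℝ := fderiv ℝ f p (1, 0)

/-- Partial derivative in `z` of a scalar function on the parameter plane `(θ, z)`. -/
def dZ (f : ℝ × ℝ → ℝ) (p : ℝ × ℝ) : ℝ := fderiv ℝ f p (0, 1)

/-- The two-dimensional data: the functions `z1, z2` determining the parameter domain `E`,
the metric coefficients `Ath = A_θ`, `Az = A_z`, the principal curvatures `kth = κ_θ`,
`kz = κ_z`, and the components `ut = u_t`, `uth = u_θ`, `uz = u_z` of a displacement. -/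
structure Setup2D where
  z1 : ℝ → ℝ
  z2 : ℝ → ℝ
  Ath : ℝ × ℝ → ℝ
  Az : ℝ × ℝ → ℝ
  kth : ℝ × ℝ → ℝ
  kz : ℝ × ℝ → ℝ
  ut : ℝ × ℝ → ℝ
  uth : ℝ × ℝ → ℝ
  uz : ℝ × ℝ → ℝ

namespace Setup2D

/-- The parameter domain `E = {(θ,z) : θ ∈ (0,1), z ∈ (z1 θ, z2 θ)}`. -/
def E (S : Setup2D) : Set (ℝ × ℝ) :=
  {p | p.1 ∈ Ioo (0 : ℝ) 1 ∧ p.2 ∈ Ioo (S.z1 p.1) (S.z2 p.1)}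

/-- The entry `F₂₂` of the simplified gradient. -/
def F22 (S : Setup2D) (p : ℝ × ℝ) : ℝ :=
  (S.Az p * dTh S.uth p + S.Az p * S.Ath p * S.kth p * S.ut p + dZ S.Ath p * S.uz p) /
    (S.Az p * S.Ath p)

/-- The entry `F₂₃` of the simplified gradient. -/
def F23 (S : Setup2D) (p : ℝ × ℝ) : ℝ :=
  (S.Ath p * dZ S.uth p - dTh S.Az p * S.uz p) / (S.Az p * S.Ath p)

/-- The entry `F₃₂` of the simplified gradient. -/
def F32 (S : Setup2D) (p : ℝ × ℝ) : ℝ :=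
  (S.Az p * dTh S.uz p - dZ S.Ath p * S.uth p) / (S.Az p * S.Ath p)

/-- The entry `F₃₃` of the simplified gradient. -/
def F33 (S : Setup2D) (p : ℝ × ℝ) : ℝ :=
  (S.Ath p * dZ S.uz p + S.Az p * S.Ath p * S.kz p * S.ut p + dTh S.Az p * S.uth p) /
    (S.Az p * S.Ath p)

/-- `F₂₃^sym = (F₂₃ + F₃₂)/2`. -/
def F23sym (S : Setup2D) (p : ℝ × ℝ) : ℝ := (S.F23 p + S.F32 p) / 2

/-- `|F^sym|² = F₂₂² + 2 (F₂₃^sym)² + F₃₃²`. -/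
def FsymSq (S : Setup2D) (p : ℝ × ℝ) : ℝ := S.F22 p ^ 2 + 2 * S.F23sym p ^ 2 + S.F33 p ^ 2

/-- The weighted inner product `(f, g)_E = ∫_E A_θ A_z f g dθ dz`. -/
def ip (S : Setup2D) (f g : ℝ × ℝ → ℝ) : ℝ := ∫ p in S.E, S.Ath p * S.Az p * f p * g p

/-- The weighted squared norm `‖f‖²_E`. -/
def nsq (S : Setup2D) (f : ℝ × ℝ → ℝ) : ℝ := S.ip f f

/-- The weighted squared norm `‖|F^sym|‖²_E` of the simplified symmetrized gradient. -/
def nF (S : Setup2D) : ℝ := ∫ p in S.E, S.Ath p * S.Az p * S.FsymSq p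

/-- The standing context: the form of the domain, the regularity `A_θ, A_z, κ_θ, κ_z ∈ C¹`,
positivity of `A_θ, A_z` on the closure of `E`, and `u ∈ C¹`. -/
def Base (S : Setup2D) : Prop :=
  (∀ θ ∈ Icc (0 : ℝ) 1, 0 ≤ S.z1 θ ∧ S.z1 θ < S.z2 θ ∧ S.z2 θ ≤ 1) ∧
  ContDiff ℝ 1 S.Ath ∧ ContDiff ℝ 1 S.Az ∧ ContDiff ℝ 1 S.kth ∧ ContDiff ℝ 1 S.kz ∧
  (∀ p ∈ closure S.E, 0 < S.Ath p ∧ 0 < S.Az p) ∧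
  ContDiff ℝ 1 S.ut ∧ ContDiff ℝ 1 S.uth ∧ ContDiff ℝ 1 S.uz

/-- The boundary condition `u = 0` on `∂E`. -/
def BZero (S : Setup2D) : Prop := ∀ p ∈ frontier S.E, S.ut p = 0 ∧ S.uth p = 0 ∧ S.uz p = 0

/-- The additional `C²` regularity of `A_θ, A_z` and `u`. -/
def Csq (S : Setup2D) : Prop :=
  ContDiff ℝ 2 S.Ath ∧ ContDiff ℝ 2 S.Az ∧
  ContDiff ℝ 2 S.ut ∧ ContDiff ℝ 2 S.uth ∧ ContDiff ℝ 2 S.uz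

/-- The Codazzi–Gauss identity `∂_z(A_{θ,z}/A_z) + ∂_θ(A_{z,θ}/A_θ) = -A_z A_θ κ_z κ_θ`. -/
def CodazziGauss (S : Setup2D) : Prop :=
  ∀ p ∈ S.E,
    dZ (fun q => dZ S.Ath q / S.Az q) p + dTh (fun q => dTh S.Az q / S.Ath q) p =
      -(S.Az p * S.Ath p * S.kz p * S.kth p)

/-- The uniform bounds `a ≤ A_θ, A_z ≤ A` and `|∇A_θ| + |∇A_z| ≤ B` on the closure of `E`. -/
def Bounds (S : Setup2D) (a A B : ℝ) : Prop :=
  ∀ p ∈ closure S.E, a ≤ S.Ath p ∧ S.Ath p ≤ A ∧ a ≤ S.Az p ∧ S.Az p ≤ A ∧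
    ‖fderiv ℝ S.Ath p‖ + ‖fderiv ℝ S.Az p‖ ≤ B

/-- `ρ` satisfies `κ_z = ρ κ_θ` with `ρ₀ ≤ ρ ≤ ρ₁` and `|∇ρ| ≤ c2`. -/
def RhoHyp (S : Setup2D) (ρ : ℝ × ℝ → ℝ) (ρ0 ρ1 c2 : ℝ) : Prop :=
  ContDiff ℝ 1 ρ ∧ (∀ p ∈ S.E, S.kz p = ρ p * S.kth p) ∧
  (∀ p ∈ closure S.E, ρ0 ≤ ρ p ∧ ρ p ≤ ρ1 ∧ ‖fderiv ℝ ρ p‖ ≤ c2)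

/-- Nonnegativity of the curvatures and the comparability condition
`(1/c)√(κ_θ κ_z) ≤ κ_θ, κ_z ≤ c √(κ_θ κ_z)` on `E`. -/
def Comparable (S : Setup2D) (c : ℝ) : Prop :=
  ∀ p ∈ S.E, 0 ≤ S.kth p ∧ 0 ≤ S.kz p ∧
    c⁻¹ * Real.sqrt (S.kth p * S.kz p) ≤ S.kth p ∧
    S.kth p ≤ c * Real.sqrt (S.kth p * S.kz p) ∧
    c⁻¹ * Real.sqrt (S.kth p * S.kz p) ≤ S.kz p ∧
    S.kz p ≤ c * Real.sqrt (S.kth p * S.kz p)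

end Setup2D

theorem countable_simple_zeros {g g' : ℝ → ℝ} (hg : ∀ x, HasDerivAt g (g' x) x) :
    {x | g x = 0 ∧ g' x ≠ 0}.Countable := by
  refine (countable_setOfPred_isolated_right_within (s := {x | g x = 0})).mono ?_
  rintro x ⟨hx, hx'⟩
  refine ⟨hx, ?_⟩
  rw [← Filter.empty_mem_iff_bot]
  have hne := ((hg x).eventually_ne (c := 0) hx').filter_mono (nhdsWithin_mono x
    (show {x | g x = 0} ∩ Ioi x ⊆ {x}ᶜ from fun y hy => ne_of_gt hy.2))
  filter_upwards [hne, self_mem_nhdsWithin] with y hy hy' using hy hy'.1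

theorem hasDerivAt_indicator_of_frontier {W : Set ℝ} (hW : IsOpen W) {g g' : ℝ → ℝ}
    (hg : ∀ x, HasDerivAt g (g' x) x) (h0 : ∀ x ∈ frontier W, g x = 0) {x : ℝ}
    (hx : ¬(g x = 0 ∧ g' x ≠ 0)) : HasDerivAt (W.indicator g) (W.indicator g' x) x := by
  by_cases hxW : x ∈ W
  · rw [indicator_of_mem hxW]
    refine (hg x).congr_of_eventuallyEq ?_
    filter_upwards [hW.mem_nhds hxW] with y hy using indicator_of_mem hy g
  rw [indicator_of_notMem hxW]
  by_cases hxc : x ∈ closure W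
  · have hgx : g x = 0 := h0 x ⟨hxc, by rwa [hW.interior_eq]⟩
    have hg'x : g' x = 0 := by
      by_contra h
      exact hx ⟨hgx, h⟩
    have hd := hg x
    rw [hasDerivAt_iff_isLittleO] at hd ⊢
    simp only [hgx, hg'x, indicator_of_notMem hxW, sub_zero, smul_zero] at hd ⊢
    exact (Asymptotics.IsBigO.of_norm_le fun y => norm_indicator_le_norm_self g y).trans_isLittleO hd.norm_left
  · refine (hasDerivAt_const x (0 : ℝ)).congr_of_eventuallyEq ?_
    filter_upwards [isClosed_closure.isOpen_compl.mem_nhds hxc] with y hy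
    exact indicator_of_notMem (fun h => hy (subset_closure h)) g

/-- No regularity of the bounded open set `W` is needed: the boundary points at which the extension
of `g` by zero is not differentiable are simple zeros of `g`, so there are countably many. -/
theorem setIntegral_deriv_eq_zero {W : Set ℝ} (hW : IsOpen W) (hb : Bornology.IsBounded W)
    {g g' : ℝ → ℝ} (hg : ∀ x, HasDerivAt g (g' x) x) (hg' : Continuous g')
    (h0 : ∀ x ∈ frontier W, g x = 0) : ∫ x in W, g' x = 0 := by
  obtain ⟨R, hR, hWR⟩ := hb.subset_ball_lt 0 0
  rw [Real.ball_eq_Ioo, zero_sub, zero_add] at hWR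
  have hcont : Continuous (W.indicator g) :=
    continuous_indicator h0 (continuous_iff_continuousAt.2 fun x => (hg x).continuousAt).continuousOn
  have hle : -R ≤ R := by linarith
  have key := integral_eq_of_hasDerivAt_off_countable_of_le (W.indicator g) (W.indicator g')
    hle (countable_simple_zeros hg) hcont.continuousOn
    (fun x hx => hasDerivAt_indicator_of_frontier hW hg h0 hx.2)
    ((intervalIntegrable_iff_integrableOn_Ioc_of_le hle).2
      ((hg'.integrableOn_Ioc).indicator hW.measurableSet))
  rw [indicator_of_notMem (fun h => (hWR h).2.false),
    indicator_of_notMem (fun h => (hWR h).1.false), sub_zero,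
    intervalIntegral.integral_of_le hle, setIntegral_indicator hW.measurableSet,
    inter_eq_self_of_subset_right (hWR.trans Ioo_subset_Ioc_self)] at key
  exact key

theorem integrableOn_of_isBounded {f : ℝ × ℝ → ℝ} {U : Set (ℝ × ℝ)} (hf : Continuous f)
    (hb : Bornology.IsBounded U) : IntegrableOn f U :=
  (hf.continuousOn.integrableOn_compact hb.isCompact_closure).mono_set subset_closure

theorem continuous_dZ {f : ℝ × ℝ → ℝ} (hf : ContDiff ℝ 1 f) : Continuous (dZ f) :=
  (hf.continuous_fderiv one_ne_zero).clm_apply continuous_const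

theorem continuous_dTh {f : ℝ × ℝ → ℝ} (hf : ContDiff ℝ 1 f) : Continuous (dTh f) :=
  (hf.continuous_fderiv one_ne_zero).clm_apply continuous_const

theorem hasDerivAt_dZ {f : ℝ × ℝ → ℝ} (hf : ContDiff ℝ 1 f) (θ z : ℝ) :
    HasDerivAt (fun z => f (θ, z)) (dZ f (θ, z)) z :=
  ((hf.differentiable one_ne_zero) (θ, z)).hasFDerivAt.comp_hasDerivAt z
    ((hasDerivAt_const z θ).prodMk (hasDerivAt_id z))

theorem hasDerivAt_dTh {f : ℝ × ℝ → ℝ} (hf : ContDiff ℝ 1 f) (θ z : ℝ) :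
    HasDerivAt (fun θ => f (θ, z)) (dTh f (θ, z)) θ :=
  ((hf.differentiable one_ne_zero) (θ, z)).hasFDerivAt.comp_hasDerivAt θ
    ((hasDerivAt_id θ).prodMk (hasDerivAt_const θ z))

theorem abs_dZ_le (f : ℝ × ℝ → ℝ) (p : ℝ × ℝ) : |dZ f p| ≤ ‖fderiv ℝ f p‖ := by
  simpa [dZ] using (fderiv ℝ f p).le_opNorm_of_le (x := ((0, 1) : ℝ × ℝ)) (c := 1) (by simp)

theorem abs_dTh_le (f : ℝ × ℝ → ℝ) (p : ℝ × ℝ) : |dTh f p| ≤ ‖fderiv ℝ f p‖ := by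
  simpa [dTh] using (fderiv ℝ f p).le_opNorm_of_le (x := ((1, 0) : ℝ × ℝ)) (c := 1) (by simp)

theorem setIntegral_dZ_eq_zero {U : Set (ℝ × ℝ)} (hU : IsOpen U) (hb : Bornology.IsBounded U)
    {f : ℝ × ℝ → ℝ} (hf : ContDiff ℝ 1 f) (h0 : ∀ p ∈ frontier U, f p = 0) :
    ∫ p in U, dZ f p = 0 := by
  have hc := continuous_dZ hf
  have hi := (integrableOn_of_isBounded hc hb).integrable_indicator hU.measurableSet
  rw [← integral_indicator hU.measurableSet, Measure.volume_eq_prod] at *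
  rw [integral_prod _ hi]
  refine integral_eq_zero_of_ae (Filter.Eventually.of_forall fun θ => ?_)
  have hm : Continuous fun z : ℝ => (θ, z) := by fun_prop
  have hW := hU.preimage hm
  change ∫ z, ((fun z : ℝ => (θ, z)) ⁻¹' U).indicator (fun z => dZ f (θ, z)) z = 0
  rw [integral_indicator hW.measurableSet]
  refine setIntegral_deriv_eq_zero (g := fun z => f (θ, z)) hW
    (hb.image_snd.subset fun z hz => ⟨_, hz, rfl⟩) (hasDerivAt_dZ hf θ) (hc.comp hm)
    fun z hz => h0 _ (hm.frontier_preimage_subset U hz)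

theorem setIntegral_dTh_eq_zero {U : Set (ℝ × ℝ)} (hU : IsOpen U) (hb : Bornology.IsBounded U)
    {f : ℝ × ℝ → ℝ} (hf : ContDiff ℝ 1 f) (h0 : ∀ p ∈ frontier U, f p = 0) :
    ∫ p in U, dTh f p = 0 := by
  have hc := continuous_dTh hf
  have hi := (integrableOn_of_isBounded hc hb).integrable_indicator hU.measurableSet
  rw [← integral_indicator hU.measurableSet, Measure.volume_eq_prod] at *
  rw [integral_prod_symm _ hi]
  refine integral_eq_zero_of_ae (Filter.Eventually.of_forall fun z => ?_)
  have hm : Continuous fun θ : ℝ => (θ, z) := by fun_prop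
  have hW := hU.preimage hm
  change ∫ θ, ((fun θ : ℝ => (θ, z)) ⁻¹' U).indicator (fun θ => dTh f (θ, z)) θ = 0
  rw [integral_indicator hW.measurableSet]
  refine setIntegral_deriv_eq_zero (g := fun θ => f (θ, z)) hW
    (hb.image_fst.subset fun θ hθ => ⟨_, hθ, rfl⟩) (fun θ => hasDerivAt_dTh hf θ z) (hc.comp hm)
    fun θ hθ => h0 _ (hm.frontier_preimage_subset U hθ)

/-- The flux identity behind the Carleman estimates: the `z`-derivative of
`e^{λz} α (ρ x² - y²)` plus the `θ`-derivative of `2 e^{λz} ρ β x y`. -/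
theorem dZ_add_dTh_flux {α β ρ x y : ℝ × ℝ → ℝ} (hα : ContDiff ℝ 1 α) (hβ : ContDiff ℝ 1 β)
    (hρ : ContDiff ℝ 1 ρ) (hx : ContDiff ℝ 1 x) (hy : ContDiff ℝ 1 y) (lam : ℝ) (p : ℝ × ℝ) :
    dZ (fun q => Real.exp (lam * q.2) * (α q * (ρ q * x q ^ 2 - y q ^ 2))) p +
        dTh (fun q => Real.exp (lam * q.2) * (2 * ρ q * β q * x q * y q)) p =
      Real.exp (lam * p.2) * (lam * (α p * (ρ p * x p ^ 2 - y p ^ 2)) +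
        ((dZ ρ p * α p + ρ p * dZ α p) * x p ^ 2 - dZ α p * y p ^ 2 +
          2 * (dTh ρ p * β p + ρ p * dTh β p) * x p * y p +
          2 * ρ p * x p * (α p * dZ x p + β p * dTh y p) +
          2 * y p * (ρ p * β p * dTh x p - α p * dZ y p))) := by
  obtain ⟨θ, z⟩ := p
  have hP : ContDiff ℝ 1
      fun q : ℝ × ℝ => Real.exp (lam * q.2) * (α q * (ρ q * x q ^ 2 - y q ^ 2)) := by fun_prop
  have hQ : ContDiff ℝ 1
      fun q : ℝ × ℝ => Real.exp (lam * q.2) * (2 * ρ q * β q * x q * y q) := by fun_prop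
  have hexp : HasDerivAt (fun z => Real.exp (lam * z)) (Real.exp (lam * z) * (lam * 1)) z :=
    ((hasDerivAt_id z).const_mul lam).exp
  rw [(hasDerivAt_dZ hP θ z).unique (hexp.mul ((hasDerivAt_dZ hα θ z).mul
      (((hasDerivAt_dZ hρ θ z).mul ((hasDerivAt_dZ hx θ z).pow 2)).sub
        ((hasDerivAt_dZ hy θ z).pow 2)))),
    (hasDerivAt_dTh hQ θ z).unique ((((((hasDerivAt_dTh hρ θ z).const_mul 2).mul
      (hasDerivAt_dTh hβ θ z)).mul (hasDerivAt_dTh hx θ z)).mul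
        (hasDerivAt_dTh hy θ z)).const_mul (Real.exp (lam * z)))]
  simp only [Pi.mul_apply, Pi.pow_apply]
  push_cast
  ring

theorem abs_mul_mul_le_sq {c M : ℝ} (h : |c| ≤ M) (x y : ℝ) :
    |c * x * y| ≤ M * ((x ^ 2 + y ^ 2) / 2) := by
  rw [mul_assoc, abs_mul]
  refine mul_le_mul h ?_ (abs_nonneg _) ((abs_nonneg c).trans h)
  rw [abs_le]
  constructor <;> nlinarith [sq_nonneg (x + y), sq_nonneg (x - y)]

/-- The coefficient of the lower-order terms left by the flux identity. -/
def lowerOrderConst (A B ρ1 c2 : ℝ) : ℝ :=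
  2 * (c2 * A + ρ1 * B) + 2 * B + 3 * (ρ1 * B) + 2 * (ρ1 * A ^ 2) + A ^ 2

theorem abs_lowerOrder_le {A B ρ1 c2 α β ρ αz βt ρz ρt x y q s t : ℝ}
    (hα : |α| ≤ A) (hβ : |β| ≤ A) (hρ : |ρ| ≤ ρ1) (hαz : |αz| ≤ B) (hβt : |βt| ≤ B)
    (hρz : |ρz| ≤ c2) (hρt : |ρt| ≤ c2) :
    |(ρz * α + ρ * αz) * x ^ 2 - αz * y ^ 2 + 2 * (ρt * β + ρ * βt) * x * y +
        2 * ρ * x * (2 * (α * β) * s + βt * y + αz * x) +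
        2 * y * (βt * x - ρ * αz * y - α * β * (t - ρ * q))| ≤
      lowerOrderConst A B ρ1 c2 * (x ^ 2 + y ^ 2 + (q ^ 2 + 2 * s ^ 2 + t ^ 2)) := by
  have hA : 0 ≤ A := (abs_nonneg _).trans hα
  have hB : 0 ≤ B := (abs_nonneg _).trans hαz
  have hρ1 : 0 ≤ ρ1 := (abs_nonneg _).trans hρ
  have hc2 : 0 ≤ c2 := (abs_nonneg _).trans hρz
  have hmul {u v U V : ℝ} (hu : |u| ≤ U) (hv : |v| ≤ V) : |u * v| ≤ U * V :=
    (abs_mul u v).trans_le (mul_le_mul hu hv (abs_nonneg v) ((abs_nonneg u).trans hu))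
  have hadd {u v U V : ℝ} (hu : |u| ≤ U) (hv : |v| ≤ V) : |u + v| ≤ U + V :=
    (abs_add_le u v).trans (add_le_add hu hv)
  have hαβ : |α * β| ≤ A ^ 2 := (hmul hα hβ).trans_eq (sq A).symm
  have h1 := abs_le.1 (abs_mul_mul_le_sq (hadd (hmul hρz hα) (hmul hρ hαz)) x x)
  have h2 := abs_le.1 (abs_mul_mul_le_sq hαz y y)
  have h3 := abs_le.1 (abs_mul_mul_le_sq (hadd (hmul hρt hβ) (hmul hρ hβt)) x y)
  have h4 := abs_le.1 (abs_mul_mul_le_sq (hmul hρ hαβ) x s)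
  have h5 := abs_le.1 (abs_mul_mul_le_sq (hmul hρ hβt) x y)
  have h6 := abs_le.1 (abs_mul_mul_le_sq (hmul hρ hαz) x x)
  have h7 := abs_le.1 (abs_mul_mul_le_sq hβt x y)
  have h8 := abs_le.1 (abs_mul_mul_le_sq (hmul hρ hαz) y y)
  have h9 := abs_le.1 (abs_mul_mul_le_sq hαβ y t)
  have h10 := abs_le.1 (abs_mul_mul_le_sq (hmul hρ hαβ) y q)
  have hpos (w : ℝ) : 0 ≤ c2 * A * w ^ 2 ∧ 0 ≤ ρ1 * B * w ^ 2 ∧ 0 ≤ B * w ^ 2 ∧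
      0 ≤ ρ1 * A ^ 2 * w ^ 2 ∧ 0 ≤ A ^ 2 * w ^ 2 := by
    refine ⟨?_, ?_, ?_, ?_, ?_⟩ <;> positivity
  obtain ⟨x1, x2, x3, x4, x5⟩ := hpos x
  obtain ⟨y1, y2, y3, y4, y5⟩ := hpos y
  obtain ⟨q1, q2, q3, q4, q5⟩ := hpos q
  obtain ⟨s1, s2, s3, s4, s5⟩ := hpos s
  obtain ⟨t1, t2, t3, t4, t5⟩ := hpos t
  rw [lowerOrderConst, abs_le]
  constructor <;> linarith

theorem le_of_absorb {m M K lam X Y F : ℝ} (hm : 0 < m) (hM : 0 ≤ M) (hK : 0 < K)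
    (hX : 0 ≤ X) (hY : 0 ≤ Y) (hF : 0 ≤ F) (hlam : 2 * K / m ≤ lam)
    (h : lam * (m * X) ≤ lam * (M * Y) + K * (X + Y + F)) :
    X ≤ (2 * M / m + 1 + 2 * K / m) * (lam⁻¹ * F + Y) := by
  have hl : 0 < lam := lt_of_lt_of_le (by positivity) hlam
  have h2K : 2 * K ≤ lam * m := (div_le_iff₀ hm).1 hlam
  have hmain : X ≤ (2 * M / m + 1) * Y + 2 * K / m * (lam⁻¹ * F) := by
    refine le_of_mul_le_mul_left ?_ (mul_pos hl hm)
    have hexp : lam * m * ((2 * M / m + 1) * Y + 2 * K / m * (lam⁻¹ * F)) =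
        2 * (lam * (M * Y)) + lam * m * Y + 2 * (K * F) := by
      field_simp
    rw [hexp]
    linarith [mul_le_mul_of_nonneg_right h2K hX, mul_le_mul_of_nonneg_right h2K hY]
  have h1 : 0 ≤ 2 * M / m + 1 := by positivity
  have h2 : 0 ≤ 2 * K / m * Y := by positivity
  have h3 : 0 ≤ (2 * M / m + 1) * (lam⁻¹ * F) := by positivity
  linarith

theorem integral_le_of_absorb {X : Type*} [MeasurableSpace X] {μ : Measure X} {f g h d : X → ℝ}
    {m M K lam : ℝ} (hm : 0 < m) (hM : 0 ≤ M) (hK : 0 < K) (hlam : 2 * K / m ≤ lam)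
    (hf : Integrable f μ) (hg : Integrable g μ) (hh : Integrable h μ) (hd : Integrable d μ)
    (hf0 : 0 ≤ f) (hg0 : 0 ≤ g) (hh0 : 0 ≤ h) (hd0 : ∫ x, d x ∂μ = 0)
    (hle : ∀ᵐ x ∂μ, lam * (m * f x) ≤ lam * (M * g x) + K * (f x + g x + h x) + d x) :
    ∫ x, f x ∂μ ≤ (2 * M / m + 1 + 2 * K / m) * (lam⁻¹ * ∫ x, h x ∂μ + ∫ x, g x ∂μ) := by
  refine le_of_absorb hm hM hK (integral_nonneg hf0) (integral_nonneg hg0) (integral_nonneg hh0)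
    hlam ?_
  have hfg : Integrable (fun x => f x + g x) μ := hf.add hg
  have hfgh : Integrable (fun x => K * (f x + g x + h x)) μ := (hfg.add hh).const_mul K
  have hg' : Integrable (fun x => lam * (M * g x)) μ := (hg.const_mul M).const_mul lam
  have hsum : Integrable (fun x => lam * (M * g x) + K * (f x + g x + h x)) μ := hg'.add hfgh
  have key := integral_mono_ae ((hf.const_mul m).const_mul lam) (hsum.add hd) hle
  simp only [Pi.add_apply] at key
  rwa [integral_add hsum hd, hd0, add_zero, integral_add hg' hfgh, integral_const_mul,
    integral_const_mul, integral_const_mul, integral_const_mul, integral_const_mul,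
    integral_add hfg hh, integral_add hf hg] at key

namespace Setup2D

theorem FsymSq_nonneg (S : Setup2D) (p : ℝ × ℝ) : 0 ≤ S.FsymSq p := by
  unfold FsymSq
  positivity

theorem isBounded_E {S : Setup2D} (hS : S.Base) : Bornology.IsBounded S.E := by
  refine (Metric.isBounded_Icc ((0, 0) : ℝ × ℝ) (1, 1)).subset fun p hp => ?_
  obtain ⟨h1, -, h2⟩ := hS.1 p.1 (Ioo_subset_Icc_self hp.1)
  exact ⟨⟨hp.1.1.le, h1.trans hp.2.1.le⟩, hp.1.2.le, hp.2.2.le.trans h2⟩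

theorem continuousOn_FsymSq {S : Setup2D} (hS : S.Base) :
    ContinuousOn S.FsymSq (closure S.E) := by
  obtain ⟨-, hα, hβ, hκ, hκ', hpos, hu, hx, hy⟩ := hS
  have hne : ∀ p ∈ closure S.E, S.Az p * S.Ath p ≠ 0 := fun p hp =>
    (mul_pos (hpos p hp).2 (hpos p hp).1).ne'
  have h1 := continuous_dZ hα
  have h2 := continuous_dTh hβ
  have h3 := continuous_dZ hx
  have h4 := continuous_dTh hx
  have h5 := continuous_dZ hy
  have h6 := continuous_dTh hy
  have hα := hα.continuous
  have hβ := hβ.continuous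
  have hκ := hκ.continuous
  have hκ' := hκ'.continuous
  have hu := hu.continuous
  have hx := hx.continuous
  have hy := hy.continuous
  have hden : ContinuousOn (fun p => S.Az p * S.Ath p) (closure S.E) := by fun_prop
  have c22 : ContinuousOn S.F22 (closure S.E) :=
    ContinuousOn.div (by fun_prop) hden hne
  have c23 : ContinuousOn S.F23 (closure S.E) :=
    ContinuousOn.div (by fun_prop) hden hne
  have c32 : ContinuousOn S.F32 (closure S.E) :=
    ContinuousOn.div (by fun_prop) hden hne
  have c33 : ContinuousOn S.F33 (closure S.E) :=
    ContinuousOn.div (by fun_prop) hden hne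
  exact ((c22.pow 2).add (continuousOn_const.mul (((c23.add c32).div_const 2).pow 2))).add
    (c33.pow 2)

/-- The divergence of the flux used in the Carleman estimates, cut off to the interior of `E`. -/
def fluxDiv (S : Setup2D) (ρ : ℝ × ℝ → ℝ) (lam : ℝ) : ℝ × ℝ → ℝ :=
  (interior S.E).indicator fun p =>
    dZ (fun q => Real.exp (lam * q.2) *
      (S.Ath q * (ρ q * S.uth q ^ 2 - S.uz q ^ 2))) p +
    dTh (fun q => Real.exp (lam * q.2) * (2 * ρ q * S.Az q * S.uth q * S.uz q)) p

theorem integral_fluxDiv {S : Setup2D} {ρ : ℝ × ℝ → ℝ} (hS : S.Base) (h0 : S.BZero)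
    (hρ : ContDiff ℝ 1 ρ) (lam : ℝ) :
    IntegrableOn (S.fluxDiv ρ lam) S.E ∧ ∫ p in S.E, S.fluxDiv ρ lam p = 0 := by
  have hb := isBounded_E hS
  have hbU := hb.subset interior_subset
  obtain ⟨-, hα, hβ, -, -, -, -, hx, hy⟩ := hS
  have hP : ContDiff ℝ 1 fun q : ℝ × ℝ => Real.exp (lam * q.2) *
      (S.Ath q * (ρ q * S.uth q ^ 2 - S.uz q ^ 2)) := by fun_prop
  have hQ : ContDiff ℝ 1 fun q : ℝ × ℝ =>
      Real.exp (lam * q.2) * (2 * ρ q * S.Az q * S.uth q * S.uz q) := by fun_prop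
  have hcP := continuous_dZ hP
  have hcQ := continuous_dTh hQ
  refine ⟨(integrableOn_of_isBounded (hcP.add hcQ) hb).indicator measurableSet_interior, ?_⟩
  rw [fluxDiv, integral_indicator measurableSet_interior,
    Measure.restrict_restrict measurableSet_interior,
    inter_eq_self_of_subset_left interior_subset,
    integral_add (integrableOn_of_isBounded hcP hbU) (integrableOn_of_isBounded hcQ hbU),
    setIntegral_dZ_eq_zero isOpen_interior hbU hP,
    setIntegral_dTh_eq_zero isOpen_interior hbU hQ, add_zero]
  all_goals
    intro p hp
    obtain ⟨-, hx0, hy0⟩ := h0 p (frontier_interior_subset hp)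
    simp [hx0, hy0]

/-- Eliminating `u_t` from `F₂₂` and `F₃₃` shows that the flux divergence is
`λ e^{λz} A_θ (ρ u_θ² - u_z²)` up to lower-order terms. -/
theorem abs_fluxDiv_sub_le {S : Setup2D} {ρ : ℝ × ℝ → ℝ} {a A B ρ0 ρ1 c2 : ℝ}
    (hA : 0 < A) (hB : 0 < B) (hρ0 : 0 < ρ0) (hρ1 : 0 < ρ1) (hc2 : 0 < c2)
    (hS : S.Base) (h0 : S.BZero) (hbd : S.Bounds a A B) (hρ : S.RhoHyp ρ ρ0 ρ1 c2) (lam : ℝ)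
    {p : ℝ × ℝ} (hp : p ∈ closure S.E) :
    |S.fluxDiv ρ lam p - Real.exp (lam * p.2) *
        (lam * (S.Ath p * (ρ p * S.uth p ^ 2 - S.uz p ^ 2)))| ≤
      Real.exp (lam * p.2) * (lowerOrderConst A B ρ1 c2 *
        (S.uth p ^ 2 + S.uz p ^ 2 + S.FsymSq p)) := by
  have hK : 0 ≤ lowerOrderConst A B ρ1 c2 := by unfold lowerOrderConst; positivity
  by_cases hpU : p ∈ interior S.E
  · obtain ⟨-, hα, hβ, -, -, hpos, -, hx, hy⟩ := hS
    obtain ⟨hαp, hβp⟩ := hpos p hp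
    obtain ⟨-, hαA, -, hβA, hgrad⟩ := hbd p hp
    obtain ⟨hρp, hρ1p, hρg⟩ := hρ.2.2 p hp
    have hκ := hρ.2.1 p (interior_subset hpU)
    rw [fluxDiv, indicator_of_mem hpU, dZ_add_dTh_flux hα hβ hρ.1 hx hy, ← mul_sub,
      add_sub_cancel_left, abs_mul, abs_of_pos (Real.exp_pos _)]
    refine mul_le_mul_of_nonneg_left ?_ (Real.exp_pos _).le
    have e1 : S.Ath p * dZ S.uth p + S.Az p * dTh S.uz p =
        2 * (S.Ath p * S.Az p) * S.F23sym p + dTh S.Az p * S.uz p + dZ S.Ath p * S.uth p := by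
      unfold F23sym F23 F32
      field_simp
      ring
    have e2 : ρ p * S.Az p * dTh S.uth p - S.Ath p * dZ S.uz p =
        dTh S.Az p * S.uth p - ρ p * dZ S.Ath p * S.uz p -
          S.Ath p * S.Az p * (S.F33 p - ρ p * S.F22 p) := by
      unfold F33 F22
      rw [hκ]
      field_simp
      ring
    rw [e1, e2]
    refine abs_lowerOrder_le ?_ ?_ ?_ ?_ ?_ ((abs_dZ_le ρ p).trans hρg)
      ((abs_dTh_le ρ p).trans hρg)
    · rwa [abs_of_pos hαp]
    · rwa [abs_of_pos hβp]
    · rwa [abs_of_pos (hρ0.trans_le hρp)]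
    · linarith [abs_dZ_le S.Ath p, norm_nonneg (fderiv ℝ S.Az p)]
    · linarith [abs_dTh_le S.Az p, norm_nonneg (fderiv ℝ S.Ath p)]
  · obtain ⟨-, hx0, hy0⟩ := h0 p ⟨hp, hpU⟩
    have := S.FsymSq_nonneg p
    rw [fluxDiv, indicator_of_notMem hpU, hx0, hy0]
    simp only [ne_eq, OfNat.ofNat_ne_zero, not_false_eq_true, zero_pow, mul_zero, sub_zero,
      abs_zero]
    positivity

end Setup2D

theorem carleman_estimates (a A B ρ0 ρ1 c2 : ℝ)
    (ha : 0 < a) (hA : 0 < A) (hB : 0 < B) (hρ0 : 0 < ρ0) (hρ1 : 0 < ρ1) (hc2 : 0 < c2) :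
    ∃ lam0 C : ℝ, 0 < lam0 ∧ 0 < C ∧
      ∀ (S : Setup2D) (ρ : ℝ × ℝ → ℝ),
        S.Base → S.BZero → S.Bounds a A B → S.RhoHyp ρ ρ0 ρ1 c2 →
        ∀ lam : ℝ, lam0 ≤ lam →
          (∫ p in S.E, Real.exp (lam * p.2) * S.uth p ^ 2) ≤
            C * (lam⁻¹ * (∫ p in S.E, Real.exp (lam * p.2) * S.FsymSq p) +
              ∫ p in S.E, Real.exp (lam * p.2) * S.uz p ^ 2) ∧
          (∫ p in S.E, Real.exp (lam * p.2) * S.uz p ^ 2) ≤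
            C * (lam⁻¹ * (∫ p in S.E, Real.exp (lam * p.2) * S.FsymSq p) +
              ∫ p in S.E, Real.exp (lam * p.2) * S.uth p ^ 2) := by
  have hK : 0 < lowerOrderConst A B ρ1 c2 := by unfold lowerOrderConst; positivity
  set K := lowerOrderConst A B ρ1 c2
  have hm : 0 < min (a * ρ0) a := lt_min (mul_pos ha hρ0) ha
  set m := min (a * ρ0) a
  have hM : 0 ≤ max (A * ρ1) A := hA.le.trans (le_max_right _ _)
  set M := max (A * ρ1) A
  refine ⟨2 * K / m, 2 * M / m + 1 + 2 * K / m, by positivity, by positivity, ?_⟩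
  intro S ρ hS h0 hbd hρ lam hlam
  have hl : 0 < lam := lt_of_lt_of_le (by positivity) hlam
  have hcompact : IsCompact (closure S.E) := (S.isBounded_E hS).isCompact_closure
  have hcF := Setup2D.continuousOn_FsymSq hS
  have hcx := hS.2.2.2.2.2.2.2.1.continuous
  have hcy := hS.2.2.2.2.2.2.2.2.continuous
  have hint {f : ℝ × ℝ → ℝ} (hf : ContinuousOn f (closure S.E)) :
      IntegrableOn (fun p => Real.exp (lam * p.2) * f p) S.E :=
    ((ContinuousOn.mul (by fun_prop) hf).integrableOn_compact hcompact).mono_set subset_closure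
  have hix := hint (f := fun p => S.uth p ^ 2) (by fun_prop)
  have hiy := hint (f := fun p => S.uz p ^ 2) (by fun_prop)
  have hiF := hint hcF
  obtain ⟨hiD, hD⟩ := Setup2D.integral_fluxDiv hS h0 hρ.1 lam
  have hx0 : 0 ≤ fun p => Real.exp (lam * p.2) * S.uth p ^ 2 := fun p => by positivity
  have hy0 : 0 ≤ fun p => Real.exp (lam * p.2) * S.uz p ^ 2 := fun p => by positivity
  have hF0 : 0 ≤ fun p => Real.exp (lam * p.2) * S.FsymSq p :=
    fun p => mul_nonneg (Real.exp_pos _).le (S.FsymSq_nonneg p)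
  have hae {q : ℝ × ℝ → Prop} (hq : ∀ p ∈ closure S.E, q p) : ∀ᵐ p ∂volume.restrict S.E, q p :=
    ae_restrict_of_ae_restrict_of_subset subset_closure
      (ae_restrict_of_forall_mem isClosed_closure.measurableSet hq)
  have hbounds {p : ℝ × ℝ} (hp : p ∈ closure S.E) :
      m ≤ S.Ath p * ρ p ∧ S.Ath p * ρ p ≤ M ∧ m ≤ S.Ath p ∧ S.Ath p ≤ M := by
    obtain ⟨h1, h2, -⟩ := hbd p hp
    obtain ⟨h3, h4, -⟩ := hρ.2.2 p hp
    exact ⟨(min_le_left _ _).trans (mul_le_mul h1 h3 hρ0.le (ha.le.trans h1)),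
      (mul_le_mul h2 h4 (hρ0.le.trans h3) hA.le).trans (le_max_left _ _),
      (min_le_right _ _).trans h1, h2.trans (le_max_right _ _)⟩
  have hflux {p : ℝ × ℝ} (hp : p ∈ closure S.E) :=
    abs_le.1 (Setup2D.abs_fluxDiv_sub_le hA hB hρ0 hρ1 hc2 hS h0 hbd hρ lam hp)
  have hscale {r s : ℝ} (p : ℝ × ℝ) (v : ℝ) (hrs : r ≤ s) :
      lam * Real.exp (lam * p.2) * (r * v ^ 2) ≤ lam * Real.exp (lam * p.2) * (s * v ^ 2) :=
    mul_le_mul_of_nonneg_left (mul_le_mul_of_nonneg_right hrs (sq_nonneg v)) (by positivity)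
  constructor
  · refine integral_le_of_absorb hm hM hK hlam hix hiy hiF hiD hx0 hy0 hF0 hD (hae fun p hp => ?_)
    obtain ⟨h1, -, -, h2⟩ := hbounds hp
    linarith [(hflux hp).1, hscale p (S.uth p) h1, hscale p (S.uz p) h2]
  · refine integral_le_of_absorb hm hM hK hlam hiy hix hiF hiD.neg hy0 hx0 hF0
      (by simp only [Pi.neg_apply, integral_neg, hD, neg_zero]) (hae fun p hp => ?_)
    obtain ⟨-, h1, h2, -⟩ := hbounds hp
    simp only [Pi.neg_apply]
    linarith [(hflux hp).2, hscale p (S.uth p) h1, hscale p (S.uz p) h2]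
end
end

section
/- (Estimate (4.13).) Assume additionally A_θ, A_z ∈ C²(closure of E), u ∈ C²(closure of E; ℝ³), u = 0 on ∂E, κ_θ, κ_z ≥ 0 on E, and that the Codazzi–Gauss identity ∂_z(A_{θ,z}/A_z) + ∂_θ(A_{z,θ}/A_θ) = −A_z A_θ κ_z κ_θ holds on E. Then there exists a constant C > 0 such that (F₂₂ − κ_θ u_t, F₃₃ − κ_z u_t)_E ≤ ‖√(κ_θ κ_z) u_θ‖²_E + ‖√(κ_θ κ_z) u_z‖²_E + C ‖|F^sym|‖²_E. -/
open MeasureTheory Set Real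

noncomputable section

open Filter Topology

theorem hasLineDerivAt_indicator_cutoff {X : Type*} [NormedAddCommGroup X] [NormedSpace ℝ X]
    {V : Set X} (hV : IsOpen V) {w P : X → ℝ} (e : X) (hw : Differentiable ℝ w)
    (hwpos : ∀ x ∈ V, 0 < w x) (hw0 : ∀ x ∈ frontier V, w x = 0)
    (hdw0 : ∀ x ∈ frontier V, fderiv ℝ w x = 0) (hP : DifferentiableOn ℝ P V)
    {K : ℝ} (hPK : ∀ x ∈ V, |P x| ≤ K) {c : ℝ} (hc : 0 < c) (x : X) :
    HasLineDerivAt ℝ (V.indicator fun y => w y / (w y + c) * P y)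
      (V.indicator (fun y => w y / (w y + c) * fderiv ℝ P y e +
        c / (w y + c) ^ 2 * (fderiv ℝ w y e * P y)) x) x e := by
  by_cases hx : x ∈ V
  · rw [indicator_of_mem hx]
    have h1 : HasDerivAt (fun t : ℝ => w (x + t • e)) (fderiv ℝ w x e) 0 :=
      (hw x).hasFDerivAt.hasLineDerivAt e
    have h2 : HasDerivAt (fun t : ℝ => P (x + t • e)) (fderiv ℝ P x e) 0 :=
      (hP.differentiableAt (hV.mem_nhds hx)).hasFDerivAt.hasLineDerivAt e
    have hne : w x + c ≠ 0 := by linarith [hwpos x hx]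
    have h3 := (h1.div (h1.add_const c) (by simpa using hne)).mul h2
    have h4 : HasLineDerivAt ℝ (fun y => w y / (w y + c) * P y)
        (w x / (w x + c) * fderiv ℝ P x e + c / (w x + c) ^ 2 * (fderiv ℝ w x e * P x)) x e := by
      refine HasDerivAt.congr_deriv h3 ?_
      simp only [Pi.div_apply, zero_smul, add_zero]
      field_simp
      ring
    refine h4.congr_of_eventuallyEq ?_
    filter_upwards [hV.mem_nhds hx] with y hy
    rw [indicator_of_mem hy]
  · rw [indicator_of_notMem hx]
    by_cases hx' : x ∈ closure V
    · have hxf : x ∈ frontier V := ⟨hx', fun h => hx (interior_subset h)⟩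
      have hd : HasFDerivAt w (0 : X →L[ℝ] ℝ) x := hdw0 x hxf ▸ (hw x).hasFDerivAt
      have hlo := (hasFDerivAt_iff_isLittleO_nhds_zero.1 hd)
      simp only [hw0 x hxf, sub_zero, zero_apply] at hlo
      suffices h : HasFDerivAt (V.indicator fun y => w y / (w y + c) * P y)
          (0 : X →L[ℝ] ℝ) x by simpa using h.hasLineDerivAt e
      rw [hasFDerivAt_iff_isLittleO_nhds_zero]
      simp only [indicator_of_notMem hx, sub_zero, zero_apply]
      refine Asymptotics.IsBigO.trans_isLittleO (Asymptotics.IsBigO.of_bound (K / c)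
        (Eventually.of_forall fun h => ?_)) hlo
      by_cases hy : x + h ∈ V
      · rw [indicator_of_mem hy]
        have hp := hwpos _ hy
        have hK := hPK _ hy
        rw [norm_mul, Real.norm_eq_abs, Real.norm_eq_abs, Real.norm_eq_abs,
          abs_of_pos (div_pos hp (by linarith)), abs_of_pos hp]
        calc w (x + h) / (w (x + h) + c) * |P (x + h)| ≤ w (x + h) / c * K := by
              gcongr
              linarith
          _ = K / c * w (x + h) := by ring
      · rw [indicator_of_notMem hy, norm_zero]
        by_cases hVe : V.Nonempty
        · obtain ⟨y, hy⟩ := hVe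
          have : 0 ≤ K := (abs_nonneg _).trans (hPK y hy)
          positivity
        · rw [not_nonempty_iff_eq_empty.1 hVe] at hxf
          simp at hxf
    · have h4 : HasLineDerivAt ℝ (fun _ : X => (0 : ℝ)) 0 x e := by
        simpa using (hasFDerivAt_const (0 : ℝ) x).hasLineDerivAt e
      refine h4.congr_of_eventuallyEq ?_
      filter_upwards [isClosed_closure.isOpen_compl.mem_nhds hx'] with y hy
      rw [indicator_of_notMem fun h => hy (subset_closure h)]

theorem integral_eq_zero_of_hasLineDerivAt {X : Type*} [NormedAddCommGroup X] [NormedSpace ℝ X]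
    [FiniteDimensional ℝ X] [MeasurableSpace X] [BorelSpace X] (μ : Measure X)
    [μ.IsAddHaarMeasure] {g g' : X → ℝ} {e : X} (hg : Integrable g μ) (hg' : Integrable g' μ)
    (h : ∀ x, HasLineDerivAt ℝ g (g' x) x e) : ∫ x, g' x ∂μ = 0 := by
  have := integral_bilinear_hasLineDerivAt_right_eq_neg_left_of_integrable (μ := μ)
    (f := fun _ => (1 : ℝ)) (f' := fun _ => 0) (g := g) (g' := g') (v := e)
    (B := ContinuousLinearMap.mul ℝ ℝ) (by simp) (by simpa using hg') (by simpa using hg)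
    (fun x _ => by simpa using (hasFDerivAt_const (1 : ℝ) x).hasLineDerivAt e) (fun x _ => h x)
  simpa using this

/-- If `w > 0` on the open set `V` vanishes with its gradient on `frontier V`, and `P` is controlled
by `w` in the sense that `∂ₑw * P = O(w)`, then `∂ₑP` has zero integral over `V`. No regularity of
`V` is needed: one integrates the derivative of `w / (w + c) * P` and lets `c` tend to `0`. -/
theorem setIntegral_fderiv_eq_zero {X : Type*} [NormedAddCommGroup X] [NormedSpace ℝ X]
    [FiniteDimensional ℝ X] [MeasurableSpace X] [BorelSpace X] (μ : Measure X)
    [μ.IsAddHaarMeasure] {V : Set X} (hV : IsOpen V) (hμ : μ V ≠ ⊤) {w P : X → ℝ} (e : X)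
    (hw : ContDiff ℝ 1 w) (hwpos : ∀ x ∈ V, 0 < w x) (hw0 : ∀ x ∈ frontier V, w x = 0)
    (hdw0 : ∀ x ∈ frontier V, fderiv ℝ w x = 0) (hP : DifferentiableOn ℝ P V)
    (hint : IntegrableOn (fun x => fderiv ℝ P x e) V μ) {K : ℝ} (hPK : ∀ x ∈ V, |P x| ≤ K)
    (hwPK : ∀ x ∈ V, |fderiv ℝ w x e * P x| ≤ K * w x) :
    ∫ x in V, fderiv ℝ P x e ∂μ = 0 := by
  set G : ℝ → X → ℝ := fun c y => w y / (w y + c) * P y with hG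
  set G' : ℝ → X → ℝ := fun c y => w y / (w y + c) * fderiv ℝ P y e +
    c / (w y + c) ^ 2 * (fderiv ℝ w y e * P y) with hG'
  have hwc : ContinuousOn w V := hw.continuous.continuousOn
  have hdwc : ContinuousOn (fun y => fderiv ℝ w y e) V :=
    (hw.continuous_fderiv_apply (by norm_num) |>.comp
      (continuous_id.prodMk continuous_const)).continuousOn
  have hne : ∀ c > 0, ∀ x ∈ V, w x + c ≠ 0 := fun c hc x hx => by linarith [hwpos x hx]
  have hVm := hV.measurableSet
  have hcK : IntegrableOn (fun _ => K) V μ := integrableOn_const hμ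
  have hle1 : ∀ c > 0, ∀ x ∈ V, |w x / (w x + c)| ≤ 1 := fun c hc x hx => by
    have := hwpos x hx
    rw [abs_of_pos (by positivity), div_le_one (by linarith)]
    linarith
  have hGint : ∀ c > 0, IntegrableOn (G c) V μ := fun c hc => by
    refine Integrable.mono' hcK ?_ ?_
    · exact ((hwc.div (hwc.add continuousOn_const) (hne c hc)).mul
        hP.continuousOn).aestronglyMeasurable hVm
    · refine (ae_restrict_iff' hVm).2 (Eventually.of_forall fun x hx => ?_)
      rw [Real.norm_eq_abs, abs_mul]
      calc _ ≤ 1 * K := mul_le_mul (hle1 c hc x hx) (hPK x hx) (abs_nonneg _) zero_le_one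
        _ = K := one_mul K
  have hmeas : ∀ c > 0, AEStronglyMeasurable (G' c) (μ.restrict V) := fun c hc => by
    refine AEStronglyMeasurable.add ?_ ?_
    · exact ((hwc.div (hwc.add continuousOn_const) (hne c hc)).aestronglyMeasurable hVm).mul
        hint.aestronglyMeasurable
    · exact ((continuousOn_const.div ((hwc.add continuousOn_const).pow 2)
        fun x hx => pow_ne_zero 2 (hne c hc x hx)).mul
          (hdwc.mul hP.continuousOn)).aestronglyMeasurable hVm
  have hbound : ∀ c > 0, ∀ᵐ x ∂(μ.restrict V), ‖G' c x‖ ≤ |fderiv ℝ P x e| + K := fun c hc => by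
    refine (ae_restrict_iff' hVm).2 (Eventually.of_forall fun x hx => ?_)
    have hp := hwpos x hx
    have hK0 : 0 ≤ K := (abs_nonneg _).trans (hPK x hx)
    refine (norm_add_le _ _).trans (add_le_add ?_ ?_)
    · rw [Real.norm_eq_abs, abs_mul]
      exact mul_le_of_le_one_left (abs_nonneg _) (hle1 c hc x hx)
    · rw [Real.norm_eq_abs, abs_mul, abs_of_pos (show 0 < c / (w x + c) ^ 2 by positivity)]
      calc _ ≤ c / (w x + c) ^ 2 * (K * w x) := by gcongr; exact hwPK x hx
        _ = K * (c * w x / (w x + c) ^ 2) := by ring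
        _ ≤ K * 1 := by
          gcongr
          rw [div_le_one (by positivity)]
          nlinarith
        _ = K := mul_one K
  have hbint : IntegrableOn (fun x => |fderiv ℝ P x e| + K) V μ := hint.abs.add hcK
  have hzero : ∀ c > 0, ∫ x in V, G' c x ∂μ = 0 := fun c hc => by
    rw [← integral_indicator hVm]
    refine integral_eq_zero_of_hasLineDerivAt μ (g := V.indicator (G c)) (e := e)
      ((integrable_indicator_iff hVm).2 (hGint c hc))
      ((integrable_indicator_iff hVm).2 (hbint.mono' (hmeas c hc) (hbound c hc)))
      (hasLineDerivAt_indicator_cutoff hV e (hw.differentiable (by norm_num)) hwpos hw0 hdw0 hP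
        hPK hc)
  have hlim : Tendsto (fun c => ∫ x in V, G' c x ∂μ) (𝓝[>] 0)
      (𝓝 (∫ x in V, fderiv ℝ P x e ∂μ)) := by
    refine tendsto_integral_filter_of_dominated_convergence _
      (eventually_mem_nhdsWithin.mono hmeas) (eventually_mem_nhdsWithin.mono hbound) hbint ?_
    refine (ae_restrict_iff' hVm).2 (Eventually.of_forall fun x hx => ?_)
    have hp := (hwpos x hx).ne'
    have hcont : ContinuousAt (fun c => G' c x) 0 := by
      simp only [hG']
      fun_prop (disch := simpa using hp)
    have := hcont.tendsto.mono_left (nhdsWithin_le_nhds (s := Ioi 0))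
    simpa [hG', div_self hp] using this
  refine tendsto_nhds_unique hlim (tendsto_const_nhds.congr' ?_)
  filter_upwards [self_mem_nhdsWithin] with c hc using (hzero c hc).symm

theorem measure_zero_inter_jacobian_ne_zero_eq_zero {u v : ℝ × ℝ → ℝ} (hu : Differentiable ℝ u)
    (hv : Differentiable ℝ v) :
    volume {p : ℝ × ℝ | (u p = 0 ∧ v p = 0) ∧
      fderiv ℝ u p (1, 0) * fderiv ℝ v p (0, 1) - fderiv ℝ u p (0, 1) * fderiv ℝ v p (1, 0) ≠ 0}
      = 0 := by
  refine measure_null_of_locally_null _ fun p hp => ⟨{p}, ?_, measure_singleton p⟩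
  have hd : HasFDerivAt (fun q => (u q, v q)) ((fderiv ℝ u p).prod (fderiv ℝ v p)) p :=
    (hu p).hasFDerivAt.prodMk (hv p).hasFDerivAt
  have hker : LinearMap.ker ((fderiv ℝ u p).prod (fderiv ℝ v p)).toLinearMap = ⊥ := by
    refine LinearMap.ker_eq_bot'.2 fun z hz => ?_
    have hlin : ∀ L : ℝ × ℝ →L[ℝ] ℝ, L z = z.1 * L (1, 0) + z.2 * L (0, 1) := fun L => by
      have : z = z.1 • ((1, 0) : ℝ × ℝ) + z.2 • ((0, 1) : ℝ × ℝ) := by ext <;> simp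
      calc L z = L (z.1 • ((1, 0) : ℝ × ℝ) + z.2 • ((0, 1) : ℝ × ℝ)) := congrArg L this
        _ = _ := by simp only [map_add, map_smul, smul_eq_mul]
    have h1 : fderiv ℝ u p z = 0 := congrArg Prod.fst hz
    have h2 : fderiv ℝ v p z = 0 := congrArg Prod.snd hz
    rw [hlin] at h1 h2
    ext
    · refine (mul_eq_zero.1 ?_).resolve_right hp.2
      linear_combination h1 * fderiv ℝ v p (0, 1) - h2 * fderiv ℝ u p (0, 1)
    · refine (mul_eq_zero.1 ?_).resolve_right hp.2
      linear_combination h2 * fderiv ℝ u p (1, 0) - h1 * fderiv ℝ v p (1, 0)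
  obtain ⟨C, -, hC⟩ := LinearMap.exists_antilipschitzWith _ hker
  have hne := hd.eventually_ne (c := (0, 0)) ⟨C, hC⟩
  rw [eventually_nhdsWithin_iff] at hne
  rw [mem_nhdsWithin_iff_eventually]
  filter_upwards [hne] with q hq hqS
  by_contra hqp
  exact hq hqp (by simp [hqS.1.1, hqS.1.2])

theorem fderiv_sq_add_sq {X : Type*} [NormedAddCommGroup X] [NormedSpace ℝ X] {u v : X → ℝ}
    {x : X} (hu : DifferentiableAt ℝ u x) (hv : DifferentiableAt ℝ v x) :
    fderiv ℝ (fun y => u y ^ 2 + v y ^ 2) x =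
      (2 * u x) • fderiv ℝ u x + (2 * v x) • fderiv ℝ v x := by
  refine ((hu.hasFDerivAt.pow 2).add (hv.hasFDerivAt.pow 2)).fderiv.trans ?_
  simp

theorem setIntegral_fderiv_combination_eq_zero {X : Type*} [NormedAddCommGroup X]
    [NormedSpace ℝ X] [FiniteDimensional ℝ X] [MeasurableSpace X] [BorelSpace X] (μ : Measure X)
    [μ.IsAddHaarMeasure] {V K W : Set X} (hV : IsOpen V) (hK : IsCompact K) (hW : IsOpen W)
    (hVK : V ⊆ K) (hKW : K ⊆ W) {u v f g : X → ℝ} (e : X) (hu : ContDiff ℝ 1 u)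
    (hv : ContDiff ℝ 1 v) (hf : ContDiffOn ℝ 1 f W) (hg : ContDiffOn ℝ 1 g W)
    (hpos : ∀ x ∈ V, 0 < u x ^ 2 + v x ^ 2) (h0 : ∀ x ∈ frontier V, u x ^ 2 + v x ^ 2 = 0) :
    IntegrableOn (fun x => fderiv ℝ (fun y => u y * f y + v y * g y) x e) V μ ∧
      ∫ x in V, fderiv ℝ (fun y => u y * f y + v y * g y) x e ∂μ = 0 := by
  have hP : ContDiffOn ℝ 1 (fun y => u y * f y + v y * g y) W :=
    (hu.contDiffOn.mul hf).add (hv.contDiffOn.mul hg)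
  have hdP : ContinuousOn (fun x => fderiv ℝ (fun y => u y * f y + v y * g y) x e) K :=
    ((hP.continuousOn_fderiv_of_isOpen hW le_rfl).mono hKW).clm_apply continuousOn_const
  have hint := (hdP.integrableOn_compact (μ := μ) hK).mono_set hVK
  have hdir : ∀ {h : X → ℝ}, ContDiff ℝ 1 h → ContinuousOn (fun x => fderiv ℝ h x e) K :=
    fun hh => ((hh.continuous_fderiv (by norm_num)).clm_apply continuous_const).continuousOn
  have hud := hu.differentiable (by norm_num)
  have hvd := hv.differentiable (by norm_num)
  obtain ⟨M₁, hM₁⟩ := hK.exists_bound_of_continuousOn (hP.continuousOn.mono hKW)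
  obtain ⟨M₂, hM₂⟩ := hK.exists_bound_of_continuousOn
    (((hdir hu).abs.add (hdir hv).abs).add
      ((hf.continuousOn.mono hKW).abs.add (hg.continuousOn.mono hKW).abs))
  refine ⟨hint, setIntegral_fderiv_eq_zero μ hV
    ((measure_mono hVK).trans_lt hK.measure_lt_top).ne (w := fun x => u x ^ 2 + v x ^ 2) e
    ((hu.pow 2).add (hv.pow 2)) hpos h0 (fun x hx => ?_)
    ((hP.differentiableOn (by norm_num)).mono (hVK.trans hKW)) hint
    (K := max M₁ (4 * M₂ ^ 2)) (fun x hx => (hM₁ x (hVK hx)).trans (le_max_left _ _))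
    fun x hx => ?_⟩
  · have hu0 : u x = 0 := by nlinarith [h0 x hx, sq_nonneg (u x), sq_nonneg (v x)]
    have hv0 : v x = 0 := by nlinarith [h0 x hx, sq_nonneg (u x), sq_nonneg (v x)]
    rw [fderiv_sq_add_sq (hud x) (hvd x), hu0, hv0]
    simp
  · refine le_trans ?_ (mul_le_mul_of_nonneg_right (le_max_right _ _) (hpos x hx).le)
    have hM := hM₂ x (hVK hx)
    rw [Real.norm_eq_abs] at hM
    simp only [Pi.add_apply] at hM
    replace hM := (le_abs_self _).trans hM
    have hcomb : ∀ s t : ℝ, |s| ≤ M₂ → |t| ≤ M₂ →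
        |u x * s + v x * t| ≤ M₂ * (|u x| + |v x|) := fun s t hs ht => by
      refine (abs_add_le _ _).trans ?_
      rw [abs_mul, abs_mul]
      nlinarith [abs_nonneg (u x), abs_nonneg (v x)]
    have n1 := abs_nonneg (fderiv ℝ u x e)
    have n2 := abs_nonneg (fderiv ℝ v x e)
    have n3 := abs_nonneg (f x)
    have n4 := abs_nonneg (g x)
    have hA := hcomb (fderiv ℝ u x e) (fderiv ℝ v x e) (by linarith) (by linarith)
    have hB := hcomb (f x) (g x) (by linarith) (by linarith)
    have hrw : fderiv ℝ (fun y => u y ^ 2 + v y ^ 2) x e * (u x * f x + v x * g x) =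
        2 * ((u x * fderiv ℝ u x e + v x * fderiv ℝ v x e) * (u x * f x + v x * g x)) := by
      rw [fderiv_sq_add_sq (hud x) (hvd x)]
      simp only [add_apply, smul_apply, smul_eq_mul]
      ring
    rw [hrw, abs_mul, abs_mul, abs_two]
    have hAB := mul_le_mul hA hB (abs_nonneg _) ((abs_nonneg _).trans hA)
    have : (|u x| + |v x|) ^ 2 ≤ 2 * (u x ^ 2 + v x ^ 2) := by
      rw [← sq_abs (u x), ← sq_abs (v x)]
      nlinarith [sq_nonneg (|u x| - |v x|)]
    nlinarith [sq_nonneg M₂]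

theorem contDiff_dTh {f : ℝ × ℝ → ℝ} (hf : ContDiff ℝ 2 f) : ContDiff ℝ 1 (dTh f) :=
  (hf.fderiv_right (m := 1) (by norm_num)).clm_apply contDiff_const

theorem contDiff_dZ {f : ℝ × ℝ → ℝ} (hf : ContDiff ℝ 2 f) : ContDiff ℝ 1 (dZ f) :=
  (hf.fderiv_right (m := 1) (by norm_num)).clm_apply contDiff_const

theorem dTh_dZ_comm {f : ℝ × ℝ → ℝ} (hf : ContDiff ℝ 2 f) (p : ℝ × ℝ) :
    dTh (dZ f) p = dZ (dTh f) p := by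
  have hs : IsSymmSndFDerivAt ℝ f p := hf.contDiffAt.isSymmSndFDerivAt (by simp)
  have hd : DifferentiableAt ℝ (fderiv ℝ f) p :=
    (hf.fderiv_right (m := 1) (by norm_num)).differentiable (by norm_num) p
  have happ : ∀ e e' : ℝ × ℝ,
      fderiv ℝ (fun q => fderiv ℝ f q e) p e' = fderiv ℝ (fderiv ℝ f) p e' e := fun e e' => by
    rw [fderiv_clm_apply hd (differentiableAt_const e)]
    simp
  exact (happ _ _).trans ((hs.eq _ _).trans (happ _ _).symm)

/-- The divergence of the flux field behind `Setup2D.nullDensity`. -/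
theorem dTh_add_dZ_flux {u v a b : ℝ × ℝ → ℝ} {p : ℝ × ℝ} (hu : ContDiff ℝ 2 u)
    (hv : ContDiff ℝ 2 v) (ha : DifferentiableAt ℝ a p) (hb : DifferentiableAt ℝ b p) :
    dTh (fun q => u q * (dZ v q + b q * u q / 2) + v q * (b q * v q / 2)) p +
      dZ (fun q => u q * (-dTh v q + a q * u q / 2) + v q * (a q * v q / 2)) p =
    dTh u p * dZ v p - dZ u p * dTh v p + b p * (u p * dTh u p + v p * dTh v p) +
      a p * (u p * dZ u p + v p * dZ v p) +
      (dZ a p + dTh b p) * (u p ^ 2 + v p ^ 2) / 2 := by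
  have hu' := (hu.differentiable (by norm_num) p).hasFDerivAt
  have hv' := (hv.differentiable (by norm_num) p).hasFDerivAt
  have hvz := ((contDiff_dZ hv).differentiable (by norm_num) p).hasFDerivAt
  have hvt := ((contDiff_dTh hv).differentiable (by norm_num) p).hasFDerivAt
  have hhalf : ∀ {c h : ℝ × ℝ → ℝ}, DifferentiableAt ℝ c p → HasFDerivAt h (fderiv ℝ h p) p →
      HasFDerivAt (fun q => c q * h q / 2)
        ((1 / 2 : ℝ) • (c p • fderiv ℝ h p + h p • fderiv ℝ c p)) p := fun hc hh =>
    ((hc.hasFDerivAt.mul hh).const_mul (1 / 2)).congr_of_eventuallyEq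
      (Eventually.of_forall fun q => by simp only [Pi.mul_apply]; ring)
  have h1 := ((hu'.mul (hvz.add (hhalf hb hu'))).add (hv'.mul (hhalf hb hv'))).fderiv
  have h2 := ((hu'.mul (hvt.neg.add (hhalf ha hu'))).add (hv'.mul (hhalf ha hv'))).fderiv
  have hsymm := dTh_dZ_comm hv p
  have h1' := congrArg (fun L : ℝ × ℝ →L[ℝ] ℝ => L (1, 0)) h1
  have h2' := congrArg (fun L : ℝ × ℝ →L[ℝ] ℝ => L (0, 1)) h2
  simp only [add_apply, smul_apply, smul_eq_mul, neg_apply, Pi.add_apply, Pi.neg_apply]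
    at h1' h2'
  change dTh (fun q => u q * (dZ v q + b q * u q / 2) + v q * (b q * v q / 2)) p = _ at h1'
  change dZ (fun q => u q * (-dTh v q + a q * u q / 2) + v q * (a q * v q / 2)) p = _ at h2'
  rw [h1', h2']
  simp only [dTh, dZ] at hsymm ⊢
  linear_combination u p * hsymm

namespace Setup2D

/-- The difference of the weighted products of the diagonal and the off-diagonal entries of the
simplified gradient; it is a divergence up to a curvature term. -/
def nullDensity (S : Setup2D) (p : ℝ × ℝ) : ℝ :=
  dTh S.uth p * dZ S.uz p - dZ S.uth p * dTh S.uz p +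
    dTh S.Az p / S.Ath p * (S.uth p * dTh S.uth p + S.uz p * dTh S.uz p) +
    dZ S.Ath p / S.Az p * (S.uth p * dZ S.uth p + S.uz p * dZ S.uz p)

theorem weighted_diag_eq (S : Setup2D) {p : ℝ × ℝ} (h1 : 0 < S.Ath p) (h2 : 0 < S.Az p) :
    S.Ath p * S.Az p * (S.F22 p - S.kth p * S.ut p) * (S.F33 p - S.kz p * S.ut p) =
      S.Ath p * S.Az p * (S.F23 p * S.F32 p) + S.nullDensity p := by
  simp only [F22, F33, F23, F32, nullDensity]
  field_simp
  ring

theorem nullDensity_ae_eq_indicator (S : Setup2D) (hu : Differentiable ℝ S.uth)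
    (hv : Differentiable ℝ S.uz) :
    S.nullDensity =ᵐ[volume] {p | 0 < S.uth p ^ 2 + S.uz p ^ 2}.indicator S.nullDensity := by
  have h := measure_zero_inter_jacobian_ne_zero_eq_zero hu hv
  rw [measure_eq_zero_iff_ae_notMem] at h
  filter_upwards [h] with p hp
  by_cases hw : 0 < S.uth p ^ 2 + S.uz p ^ 2
  · rw [indicator_of_mem (by exact hw)]
  · rw [indicator_of_notMem (by exact hw)]
    have hu0 : S.uth p = 0 := by nlinarith [sq_nonneg (S.uth p), sq_nonneg (S.uz p)]
    have hv0 : S.uz p = 0 := by nlinarith [sq_nonneg (S.uth p), sq_nonneg (S.uz p)]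
    have hJ := not_not.1 fun hJ => hp ⟨⟨hu0, hv0⟩, hJ⟩
    simp only [nullDensity, hu0, hv0, dTh, dZ]
    linear_combination hJ

theorem isCompact_closure_E (S : Setup2D) (hBase : S.Base) : IsCompact (closure S.E) := by
  refine Metric.isCompact_of_isClosed_isBounded isClosed_closure (Bornology.IsBounded.closure ?_)
  refine ((Metric.isBounded_Icc (0 : ℝ) 1).prod (Metric.isBounded_Icc (0 : ℝ) 1)).subset ?_
  intro p hp
  obtain ⟨h1, -, h2⟩ := hBase.1 p.1 (Ioo_subset_Icc_self hp.1)
  exact ⟨Ioo_subset_Icc_self hp.1, h1.trans hp.2.1.le, hp.2.2.le.trans h2⟩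

/-- The part of the domain on which the tangential displacement does not vanish. -/
def support (S : Setup2D) : Set (ℝ × ℝ) := S.E ∩ {p | 0 < S.uth p ^ 2 + S.uz p ^ 2}

theorem support_eq (S : Setup2D) (hB0 : S.BZero) :
    S.support = interior S.E ∩ {p | 0 < S.uth p ^ 2 + S.uz p ^ 2} := by
  refine subset_antisymm (fun p hp => ⟨?_, hp.2⟩) (inter_subset_inter_left _ interior_subset)
  by_contra hi
  obtain ⟨-, hu, hv⟩ := hB0 p ⟨subset_closure hp.1, hi⟩
  simpa [hu, hv] using hp.2

theorem isOpen_support (S : Setup2D) (hB0 : S.BZero) (hu : Continuous S.uth)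
    (hv : Continuous S.uz) : IsOpen S.support := by
  rw [support_eq S hB0]
  exact isOpen_interior.inter (isOpen_lt continuous_const (by fun_prop))

theorem eq_zero_of_mem_frontier_support (S : Setup2D) (hB0 : S.BZero) (hu : Continuous S.uth)
    (hv : Continuous S.uz) {p : ℝ × ℝ} (hp : p ∈ frontier S.support) :
    S.uth p ^ 2 + S.uz p ^ 2 = 0 := by
  have hnot : p ∉ S.support := by
    rw [(isOpen_support S hB0 hu hv).frontier_eq] at hp
    exact hp.2
  have hcl : p ∈ closure S.E := closure_mono inter_subset_left hp.1
  by_cases hi : p ∈ interior S.E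
  · have : ¬ 0 < S.uth p ^ 2 + S.uz p ^ 2 := fun h => hnot ⟨interior_subset hi, h⟩
    nlinarith [sq_nonneg (S.uth p), sq_nonneg (S.uz p)]
  · obtain ⟨-, hu, hv⟩ := hB0 p ⟨hcl, hi⟩
    simp [hu, hv]

theorem setIntegral_nullDensity_eq (S : Setup2D) (hBase : S.Base) (hC2 : S.Csq) (hB0 : S.BZero)
    (hCG : S.CodazziGauss) :
    ∫ p in S.E, S.nullDensity p = ∫ p in S.support,
      S.Az p * S.Ath p * S.kz p * S.kth p * (S.uth p ^ 2 + S.uz p ^ 2) / 2 := by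
  have hcomp := isCompact_closure_E S hBase
  obtain ⟨-, hA, hB, hkt, hkz, hpos, -, hu, hv⟩ := hBase
  obtain ⟨hA2, hB2, -, hu2, hv2⟩ := hC2
  set W : Set (ℝ × ℝ) := {p | 0 < S.Ath p} ∩ {p | 0 < S.Az p}
  have hW : IsOpen W := (isOpen_lt continuous_const hA.continuous).inter
    (isOpen_lt continuous_const hB.continuous)
  have hV := isOpen_support S hB0 hu.continuous hv.continuous
  have hVE : S.support ⊆ closure S.E := inter_subset_left.trans subset_closure
  have ha : ContDiffOn ℝ 1 (fun q => dZ S.Ath q / S.Az q) W :=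
    (contDiff_dZ hA2).contDiffOn.div hB.contDiffOn fun p hp => hp.2.ne'
  have hb : ContDiffOn ℝ 1 (fun q => dTh S.Az q / S.Ath q) W :=
    (contDiff_dTh hB2).contDiffOn.div hA.contDiffOn fun p hp => hp.1.ne'
  have hf : ∀ {h c : ℝ × ℝ → ℝ}, ContDiff ℝ 1 h → ContDiffOn ℝ 1 c W →
      ContDiffOn ℝ 1 (fun q => c q * h q / 2) W := fun hh hc =>
    (hc.mul hh.contDiffOn).div_const 2
  have hzero := fun p hp => eq_zero_of_mem_frontier_support S hB0 hu.continuous hv.continuous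
    (p := p) hp
  obtain ⟨hi1, h1⟩ := setIntegral_fderiv_combination_eq_zero volume hV hcomp hW hVE hpos
    (1, 0) hu hv ((contDiff_dZ hv2).contDiffOn.add (hf hu hb)) (hf hv hb) (fun p hp => hp.2) hzero
  obtain ⟨hi2, h2⟩ := setIntegral_fderiv_combination_eq_zero volume hV hcomp hW hVE hpos
    (0, 1) hu hv ((contDiff_dTh hv2).neg.contDiffOn.add (hf hu ha)) (hf hv ha)
    (fun p hp => hp.2) hzero
  have hcurv : IntegrableOn (fun p => S.Az p * S.Ath p * S.kz p * S.kth p *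
      (S.uth p ^ 2 + S.uz p ^ 2) / 2) S.support := by
    refine IntegrableOn.mono_set (ContinuousOn.integrableOn_compact hcomp ?_) hVE
    have := hA.continuous
    have := hB.continuous
    have := hkt.continuous
    have := hkz.continuous
    have := hu.continuous
    have := hv.continuous
    fun_prop
  rw [integral_congr_ae (ae_restrict_of_ae (nullDensity_ae_eq_indicator S
    (hu.differentiable (by norm_num)) (hv.differentiable (by norm_num)))),
    setIntegral_indicator (measurableSet_lt measurable_const
      (by have := hu.continuous; have := hv.continuous; fun_prop))]
  change ∫ p in S.support, S.nullDensity p = _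
  rw [setIntegral_congr_fun hV.measurableSet (fun p hp => ?_), integral_add (hi1.add hi2) hcurv,
    integral_add' hi1 hi2, h1, h2, zero_add, zero_add]
  have hpW : W ∈ nhds p := hW.mem_nhds (hpos p (hVE hp))
  have hflux := dTh_add_dZ_flux hu2 hv2 ((ha.contDiffAt hpW).differentiableAt (by norm_num))
    ((hb.contDiffAt hpW).differentiableAt (by norm_num))
  have hcg := hCG p hp.1
  rw [hcg] at hflux
  simp only [nullDensity]
  simp only [dTh, dZ, Pi.add_apply] at hflux ⊢
  linear_combination -hflux

end Setup2D

theorem estimate_4_13 (S : Setup2D) (hBase : S.Base) (hC2 : S.Csq) (hB0 : S.BZero)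
    (hCG : S.CodazziGauss) (hκ : ∀ p ∈ S.E, 0 ≤ S.kth p ∧ 0 ≤ S.kz p) :
    ∃ C : ℝ, 0 < C ∧
      S.ip (fun p => S.F22 p - S.kth p * S.ut p) (fun p => S.F33 p - S.kz p * S.ut p) ≤
        S.nsq (fun p => Real.sqrt (S.kth p * S.kz p) * S.uth p) +
        S.nsq (fun p => Real.sqrt (S.kth p * S.kz p) * S.uz p) + C * S.nF := by
  have hcomp := S.isCompact_closure_E hBase
  have hnull := S.setIntegral_nullDensity_eq hBase hC2 hB0 hCG
  obtain ⟨-, hA, hB, hkt, hkz, hpos, hut, hu, hv⟩ := hBase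
  have hV := S.isOpen_support hB0 hu.continuous hv.continuous
  have hVE : S.support ⊆ S.E := inter_subset_left
  have hae : ∀ᵐ p ∂(volume.restrict S.E), p ∈ closure S.E :=
    (ae_mono (Measure.restrict_mono_set _ subset_closure))
      (ae_restrict_mem isClosed_closure.measurableSet)
  have hint : ∀ {f : ℝ × ℝ → ℝ}, ContinuousOn f (closure S.E) → IntegrableOn f S.E :=
    fun hf => (hf.integrableOn_compact hcomp).mono_set subset_closure
  have hdTh : ∀ {f : ℝ × ℝ → ℝ}, ContDiff ℝ 1 f → ContinuousOn (dTh f) (closure S.E) :=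
    fun hf => ((hf.continuous_fderiv (by norm_num)).clm_apply continuous_const).continuousOn
  have hdZ : ∀ {f : ℝ × ℝ → ℝ}, ContDiff ℝ 1 f → ContinuousOn (dZ f) (closure S.E) :=
    fun hf => ((hf.continuous_fderiv (by norm_num)).clm_apply continuous_const).continuousOn
  have cA := hA.continuous
  have cB := hB.continuous
  have ckt := hkt.continuous
  have ckz := hkz.continuous
  have cut := hut.continuous
  have cu := hu.continuous
  have cv := hv.continuous
  have d1 := hdTh hu
  have d2 := hdTh hv
  have d3 := hdTh hB
  have d4 := hdZ hu
  have d5 := hdZ hv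
  have d6 := hdZ hA
  have hne : ∀ p ∈ closure S.E, S.Az p * S.Ath p ≠ 0 := fun p hp =>
    (mul_pos (hpos p hp).2 (hpos p hp).1).ne'
  have c22 : ContinuousOn S.F22 (closure S.E) := by
    refine ContinuousOn.div ?_ ?_ hne <;> fun_prop
  have c23 : ContinuousOn S.F23 (closure S.E) := by
    refine ContinuousOn.div ?_ ?_ hne <;> fun_prop
  have c32 : ContinuousOn S.F32 (closure S.E) := by
    refine ContinuousOn.div ?_ ?_ hne <;> fun_prop
  have c33 : ContinuousOn S.F33 (closure S.E) := by
    refine ContinuousOn.div ?_ ?_ hne <;> fun_prop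
  have iN : IntegrableOn (fun p => S.Ath p * S.Az p * (S.F23 p * S.F32 p)) S.E :=
    hint (by fun_prop)
  have iD : IntegrableOn S.nullDensity S.E := by
    refine hint ?_
    have q1 : ContinuousOn (fun p => dTh S.Az p / S.Ath p) (closure S.E) :=
      d3.div cA.continuousOn fun p hp => (hpos p hp).1.ne'
    have q2 : ContinuousOn (fun p => dZ S.Ath p / S.Az p) (closure S.E) :=
      d6.div cB.continuousOn fun p hp => (hpos p hp).2.ne'
    unfold Setup2D.nullDensity
    fun_prop
  have iF : IntegrableOn (fun p => S.Ath p * S.Az p * S.FsymSq p) S.E := by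
    refine hint ?_
    unfold Setup2D.FsymSq Setup2D.F23sym
    fun_prop
  have iK : ∀ {h : ℝ × ℝ → ℝ}, Continuous h → IntegrableOn (fun p => S.Ath p * S.Az p *
      (√(S.kth p * S.kz p) * h p) * (√(S.kth p * S.kz p) * h p)) S.E := fun hh =>
    hint (by fun_prop)
  have hnn : ∀ᵐ p ∂(volume.restrict S.E), 0 ≤ S.Ath p * S.Az p *
      (√(S.kth p * S.kz p) * S.uth p) * (√(S.kth p * S.kz p) * S.uth p) +
      S.Ath p * S.Az p * (√(S.kth p * S.kz p) * S.uz p) * (√(S.kth p * S.kz p) * S.uz p) := by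
    filter_upwards [hae] with p hp
    have h1 := (hpos p hp).1
    have h2 := (hpos p hp).2
    rw [mul_assoc, mul_assoc _ _ (√(S.kth p * S.kz p) * S.uz p)]
    exact add_nonneg (mul_nonneg (by positivity) (mul_self_nonneg _))
      (mul_nonneg (by positivity) (mul_self_nonneg _))
  refine ⟨1, one_pos, ?_⟩
  have hsplit : S.ip (fun p => S.F22 p - S.kth p * S.ut p) (fun p => S.F33 p - S.kz p * S.ut p) =
      (∫ p in S.E, S.Ath p * S.Az p * (S.F23 p * S.F32 p)) + ∫ p in S.E, S.nullDensity p := by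
    rw [← integral_add iN iD]
    exact integral_congr_ae (hae.mono fun p hp => S.weighted_diag_eq (hpos p hp).1 (hpos p hp).2)
  have hN : ∫ p in S.E, S.Ath p * S.Az p * (S.F23 p * S.F32 p) ≤ S.nF := by
    refine integral_mono_ae iN iF (hae.mono fun p hp => ?_)
    have h12 := mul_pos (hpos p hp).1 (hpos p hp).2
    refine mul_le_mul_of_nonneg_left ?_ h12.le
    simp only [Setup2D.FsymSq, Setup2D.F23sym]
    nlinarith [sq_nonneg (S.F22 p), sq_nonneg (S.F33 p), sq_nonneg (S.F23 p - S.F32 p),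
      sq_nonneg (S.F23 p + S.F32 p)]
  have hD : ∫ p in S.E, S.nullDensity p ≤
      S.nsq (fun p => Real.sqrt (S.kth p * S.kz p) * S.uth p) +
        S.nsq (fun p => Real.sqrt (S.kth p * S.kz p) * S.uz p) := by
    unfold Setup2D.nsq Setup2D.ip
    rw [hnull, ← integral_add (iK cu) (iK cv)]
    refine le_trans ?_ (setIntegral_mono_set ((iK cu).add (iK cv)) hnn hVE.eventuallyLE)
    refine setIntegral_mono_on ((hint (by fun_prop)).mono_set hVE)
      (((iK cu).add (iK cv)).mono_set hVE) hV.measurableSet fun p hp => ?_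
    have h12 := mul_pos (hpos p (subset_closure (hVE hp))).1 (hpos p (subset_closure (hVE hp))).2
    have hk := mul_nonneg (hκ p (hVE hp)).1 (hκ p (hVE hp)).2
    have hsq := Real.mul_self_sqrt hk
    have hnonneg : 0 ≤ S.Ath p * S.Az p * (S.kth p * S.kz p) * (S.uth p ^ 2 + S.uz p ^ 2) := by
      positivity
    calc _ ≤ S.Ath p * S.Az p * (S.kth p * S.kz p) * (S.uth p ^ 2 + S.uz p ^ 2) := by linarith
      _ = _ := by
        linear_combination (-(S.Ath p * S.Az p * (S.uth p ^ 2 + S.uz p ^ 2))) * hsq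
  linarith
end
end
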